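/- arXiv:2409.06640 — 6 statements merged into one kernel-verified Lean document; each statement's English description precedes it below -/
import Mathlib

section
/- There exists an absolute constant C > 0 with the following property: for every k ∈ ℕ there exists n₀ ∈ ℕ such that for all n ≥ n₀ the following holds. Let G be a bipartite graph with parts A and B, where |A| = n and |B| = kn, such that every a ∈ A satisfies deg(a, B) ≥ (99/100)|B| and every b ∈ B satisfies deg(b, A) ≥ (99/100)|A|. Then there exists a random perfect K_{1,k}-matching M of G (with all star centres in A) such that for any collection of distinct edges e₁,…,e_s ∈ E(G), the probability that all of e₁,…,e_s belong to M is at most (C/n)^s. -/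
section SpreadStarMatching

open Finset Equiv
open scoped Classical Nat

variable {X : Type*} [Fintype X]

/-- Permutations `σ` all of whose pairs `(x, σ x)` satisfy `R`, and which agree with `c` on `T`. -/
noncomputable def permsThrough (R : X → X → Prop) (T : Finset X) (c : X → X) : Finset (Perm X) :=
  {σ | (∀ x, R x (σ x)) ∧ ∀ x ∈ T, σ x = c x}

/-- The number of pairs `(x, σ x)` violating `R`. -/
noncomputable def numBad (R : X → X → Prop) (σ : Perm X) : ℕ := #{x | ¬ R x (σ x)}

/-- Permutations with exactly `j` pairs violating `R`. -/
noncomputable def permsWithBad (R : X → X → Prop) (j : ℕ) : Finset (Perm X) :=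
  {σ | numBad R σ = j}

lemma mem_permsWithBad {R : X → X → Prop} {j : ℕ} {σ : Perm X} :
    σ ∈ permsWithBad R j ↔ #{x | ¬ R x (σ x)} = j := by
  rw [permsWithBad, mem_filter, numBad]
  simp

lemma card_filter_apply_perm (p : X → Prop) [DecidablePred p] (σ : Perm X) : #{x | p (σ x)} = #{x | p x} :=
  card_bij (fun x _ => σ x) (by simp) (by simp) fun y hy => ⟨σ.symm y, by simpa using hy, by simp⟩

/-- Most `x'` are such that exchanging the images of `x` and `x'` produces two pairs in `R`. -/
lemma le_card_switch (R : X → X → Prop) (d : ℕ) (h₁ : ∀ x, #{y | ¬ R x y} ≤ d)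
    (h₂ : ∀ y, #{x | ¬ R x y} ≤ d) (σ : Perm X) (x : X) (U : Finset X) :
    Fintype.card X - 2 * d - #U ≤ #{x' | x' ∉ U ∧ R x (σ x') ∧ R x' (σ x)} := by
  have hcov : (univ : Finset X) ⊆ ({x' | x' ∉ U ∧ R x (σ x') ∧ R x' (σ x)} : Finset X) ∪
      (U ∪ (({x' | ¬ R x (σ x')} : Finset X) ∪ ({x' | ¬ R x' (σ x)} : Finset X))) := by
    intro x' _
    simp only [mem_union, mem_filter, mem_univ, true_and]
    tauto
  have h := card_le_card hcov
  have e₁ := card_union_le ({x' | x' ∉ U ∧ R x (σ x') ∧ R x' (σ x)} : Finset X)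
    (U ∪ (({x' | ¬ R x (σ x')} : Finset X) ∪ ({x' | ¬ R x' (σ x)} : Finset X)))
  have e₂ := card_union_le U
    (({x' | ¬ R x (σ x')} : Finset X) ∪ ({x' | ¬ R x' (σ x)} : Finset X))
  have e₃ := card_union_le ({x' | ¬ R x (σ x')} : Finset X) ({x' | ¬ R x' (σ x)} : Finset X)
  have e₄ := card_filter_apply_perm (fun y => ¬ R x y) σ
  have e₅ := h₁ x
  have e₆ := h₂ (σ x)
  rw [card_univ] at h
  omega

lemma card_permsThrough_insert (R : X → X → Prop) (d : ℕ) (h₁ : ∀ x, #{y | ¬ R x y} ≤ d)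
    (h₂ : ∀ y, #{x | ¬ R x y} ≤ d) (T : Finset X) (c : X → X) (x : X) (hx : x ∉ T) :
    #(permsThrough R (insert x T) c) * (Fintype.card X - 2 * d - #T) ≤
      #(permsThrough R T c) := by
  let S : Finset (Σ _ : Perm X, X) := (permsThrough R (insert x T) c).sigma
    fun σ => {x' | x' ∉ T ∧ R x (σ x') ∧ R x' (σ x)}
  have hS : #(permsThrough R (insert x T) c) * (Fintype.card X - 2 * d - #T) ≤ #S := by
    rw [card_sigma, ← smul_eq_mul]
    exact card_nsmul_le_sum _ _ _ fun σ _ => le_card_switch R d h₁ h₂ σ x T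
  refine hS.trans (card_le_card_of_injOn (fun p => p.1 * swap x p.2) ?_ ?_)
  · rintro ⟨σ, x'⟩ hp
    simp only [S, permsThrough, coe_sigma, Set.mem_sigma_iff, coe_filter, mem_univ, true_and,
      Set.mem_ofPred_eq, mem_insert, forall_eq_or_imp] at hp ⊢
    obtain ⟨⟨hR, -, hc⟩, hx', hr, hr'⟩ := hp
    refine ⟨fun z => ?_, fun z hz => ?_⟩
    · rcases eq_or_ne z x with rfl | hzx
      · simpa using hr
      rcases eq_or_ne z x' with rfl | hzx'
      · simpa using hr'
      simpa [swap_apply_of_ne_of_ne hzx hzx'] using hR z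
    · have hzx : z ≠ x := fun h => hx (h ▸ hz)
      have hzx' : z ≠ x' := fun h => hx' (h ▸ hz)
      simpa [swap_apply_of_ne_of_ne hzx hzx'] using hc z hz
  · rintro ⟨σ, y⟩ hp ⟨τ, z⟩ hq h
    simp only [S, permsThrough, coe_sigma, Set.mem_sigma_iff, coe_filter, mem_univ, true_and,
      Set.mem_ofPred_eq, mem_insert, forall_eq_or_imp] at hp hq h
    have hy : (σ * swap x y) y = c x := by simp [hp.1.2.1]
    have hz : (τ * swap x z) z = c x := by simp [hq.1.2.1]
    have hyz : y = z := (σ * swap x y).injective (by rw [hy, h, hz])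
    subst hyz
    rw [mul_left_inj] at h
    subst h
    rfl

lemma card_permsThrough_mul_pow (R : X → X → Prop) (d m : ℕ) (h₁ : ∀ x, #{y | ¬ R x y} ≤ d)
    (h₂ : ∀ y, #{x | ¬ R x y} ≤ d) (c : X → X) (T : Finset X)
    (hT : m + 2 * d + #T ≤ Fintype.card X + 1) :
    #(permsThrough R T c) * m ^ #T ≤ #(permsThrough R ∅ c) := by
  induction T using Finset.induction_on with
  | empty => simp
  | insert x T hx ih =>
    rw [card_insert_of_notMem hx] at hT ⊢
    calc _ = #(permsThrough R (insert x T) c) * m * m ^ #T := by ring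
      _ ≤ #(permsThrough R (insert x T) c) * (Fintype.card X - 2 * d - #T) * m ^ #T := by
        gcongr; omega
      _ ≤ #(permsThrough R T c) * m ^ #T := by
        gcongr; exact card_permsThrough_insert R d h₁ h₂ T c x hx
      _ ≤ _ := ih (by omega)

lemma card_perms_mul_descFactorial (c : X → X) (T : Finset X) :
    #(permsThrough (fun _ _ => True) T c) * (Fintype.card X).descFactorial #T ≤
      (Fintype.card X)! := by
  induction T using Finset.induction_on with
  | empty => simp [permsThrough, Fintype.card_perm]
  | insert x T hx ih =>
    rw [card_insert_of_notMem hx, Nat.descFactorial_succ, ← mul_assoc]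
    refine le_trans ?_ ih
    gcongr
    simpa using card_permsThrough_insert (fun _ _ => True) 0 (by simp) (by simp) T c x hx

lemma permsThrough_empty (R : X → X → Prop) (c : X → X) :
    permsThrough R ∅ c = permsWithBad R 0 := by
  ext σ
  simp [permsThrough, permsWithBad, numBad, filter_eq_empty_iff]

lemma card_permsThrough_mul_factorial (R : X → X → Prop) (c : X → X) (T : Finset X) :
    #(permsThrough R T c) * (#T)! ≤ (Fintype.card X)! := by
  refine le_trans (Nat.mul_le_mul (card_le_card ?_) ?_) (card_perms_mul_descFactorial c T)
  · intro σ
    simp +contextual [permsThrough]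
  · rw [Nat.descFactorial_eq_factorial_mul_choose]
    exact Nat.le_mul_of_pos_right _ (Nat.choose_pos (card_le_univ T))

lemma card_permsWithBad_succ (R : X → X → Prop) (d j : ℕ) (h₁ : ∀ x, #{y | ¬ R x y} ≤ d)
    (h₂ : ∀ y, #{x | ¬ R x y} ≤ d) :
    #(permsWithBad R (j + 1)) * ((j + 1) * (Fintype.card X - 2 * d - (j + 1))) ≤
      #(permsWithBad R j) * (Fintype.card X * d) := by
  let S : Finset (Σ _ : Perm X, Σ _ : X, X) := (permsWithBad R (j + 1)).sigma fun σ =>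
    ({x | ¬ R x (σ x)} : Finset X).sigma
      fun x => {x' | x' ∉ ({z | ¬ R z (σ z)} : Finset X) ∧ R x (σ x') ∧ R x' (σ x)}
  let S' : Finset (Σ _ : Perm X, Σ _ : X, X) := (permsWithBad R j).sigma fun τ =>
    (univ : Finset X).sigma fun x => {x' | ¬ R x (τ x')}
  have hS : #(permsWithBad R (j + 1)) * ((j + 1) * (Fintype.card X - 2 * d - (j + 1))) ≤ #S := by
    rw [card_sigma, ← smul_eq_mul]
    refine card_nsmul_le_sum _ _ _ fun σ hσ => ?_
    have hσ' : #{x | ¬ R x (σ x)} = j + 1 := mem_permsWithBad.mp hσ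
    rw [card_sigma]
    nth_rewrite 1 [← hσ']
    rw [← smul_eq_mul]
    refine card_nsmul_le_sum _ _ _ fun x _ => ?_
    have h := le_card_switch R d h₁ h₂ σ x {z | ¬ R z (σ z)}
    rwa [hσ'] at h
  have hS' : #S' ≤ #(permsWithBad R j) * (Fintype.card X * d) := by
    rw [card_sigma, ← smul_eq_mul]
    refine sum_le_card_nsmul _ _ _ fun τ _ => ?_
    rw [card_sigma, ← smul_eq_mul, ← card_univ]
    refine sum_le_card_nsmul _ _ _ fun x _ => ?_
    rw [card_filter_apply_perm (fun y => ¬ R x y) τ]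
    exact h₁ x
  refine hS.trans (le_trans ?_ hS')
  refine card_le_card_of_injOn (fun p => ⟨p.1 * swap p.2.1 p.2.2, p.2⟩) ?_ ?_
  · rintro ⟨σ, x, x'⟩ hp
    simp only [S, S', mem_coe, mem_sigma, mem_permsWithBad, mem_filter, mem_univ, true_and,
      not_not] at hp ⊢
    obtain ⟨hj, hx, hx', hr, hr'⟩ := hp
    refine ⟨?_, by simpa using hx⟩
    have : ({z | ¬ R z ((σ * swap x x') z)} : Finset X) =
        ({z | ¬ R z (σ z)} : Finset X).erase x := by
      ext z
      simp only [mem_erase, mem_filter, mem_univ, true_and]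
      rcases eq_or_ne z x with rfl | hzx
      · simpa using hr
      rcases eq_or_ne z x' with rfl | hzx'
      · simp [hr', hx']
      simp [swap_apply_of_ne_of_ne hzx hzx', hzx]
    rw [this, card_erase_of_mem (by simpa using hx), hj]
    rfl
  · rintro ⟨σ, p⟩ _ ⟨τ, q⟩ _ h
    simp only [Sigma.mk.injEq, heq_eq_eq] at h
    obtain ⟨h, rfl⟩ := h
    rw [mul_left_inj] at h
    rw [h]

lemma card_permsWithBad_le (R : X → X → Prop) (d : ℕ) (hd : 100 * d ≤ Fintype.card X)
    (h₁ : ∀ x, #{y | ¬ R x y} ≤ d) (h₂ : ∀ y, #{x | ¬ R x y} ≤ d) (j : ℕ)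
    (hj : 2 * j ≤ Fintype.card X) :
    #(permsWithBad R j) * j ! ≤ #(permsWithBad R 0) * Fintype.card X ^ j := by
  induction j with
  | zero => simp
  | succ j ih =>
    have h := card_permsWithBad_succ R d j h₁ h₂
    have ih := ih (by omega)
    have hpos : 0 < Fintype.card X := by omega
    have hstep : #(permsWithBad R (j + 1)) * (j + 1) ≤ #(permsWithBad R j) * Fintype.card X := by
      rcases Nat.eq_zero_or_pos d with rfl | hd0
      · have : #(permsWithBad R (j + 1)) * ((j + 1) * (Fintype.card X - 2 * 0 - (j + 1))) = 0 := by
          simpa using h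
        have hne : (j + 1) * (Fintype.card X - 2 * 0 - (j + 1)) ≠ 0 :=
          Nat.mul_ne_zero (by omega) (by omega)
        rw [(Nat.mul_eq_zero.mp this).resolve_right hne]
        simp
      · refine Nat.le_of_mul_le_mul_right (c := d) ?_ hd0
        calc _ ≤ #(permsWithBad R (j + 1)) * (j + 1) * (Fintype.card X - 2 * d - (j + 1)) := by
              gcongr; omega
          _ ≤ _ := by rw [mul_assoc, mul_assoc]; exact h
    calc _ = #(permsWithBad R (j + 1)) * (j + 1) * j ! := by rw [Nat.factorial_succ]; ring
      _ ≤ #(permsWithBad R j) * Fintype.card X * j ! := by gcongr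
      _ = #(permsWithBad R j) * j ! * Fintype.card X := by ring
      _ ≤ #(permsWithBad R 0) * Fintype.card X ^ j * Fintype.card X := by gcongr
      _ = _ := by ring

lemma sum_numBad_le (R : X → X → Prop) (d : ℕ) (h₁ : ∀ x, #{y | ¬ R x y} ≤ d) :
    ∑ σ : Perm X, numBad R σ ≤ d * (Fintype.card X)! := by
  have hpair (x y : X) : #{σ : Perm X | σ x = y} * Fintype.card X ≤ (Fintype.card X)! := by
    simpa [permsThrough] using card_perms_mul_descFactorial (fun _ => y) {x}
  rcases Nat.eq_zero_or_pos (Fintype.card X) with h0 | hpos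
  · have : IsEmpty X := Fintype.card_eq_zero_iff.mp h0
    simp [numBad]
  refine Nat.le_of_mul_le_mul_right (c := Fintype.card X) ?_ hpos
  have hsum : ∑ σ : Perm X, numBad R σ = ∑ x, ∑ y with ¬ R x y, #{σ : Perm X | σ x = y} := by
    simp only [numBad, card_filter, sum_filter]
    rw [sum_comm]
    refine sum_congr rfl fun x _ => ?_
    simp only [← sum_filter (fun y => ¬ R x y)]
    rw [sum_comm]
    simp
  rw [hsum, sum_mul]
  calc _ ≤ ∑ x : X, d * (Fintype.card X)! := by
        refine sum_le_sum fun x _ => ?_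
        rw [sum_mul]
        calc _ ≤ #{y | ¬ R x y} • (Fintype.card X)! := sum_le_card_nsmul _ _ _ fun y _ => hpair x y
          _ ≤ _ := by rw [smul_eq_mul]; gcongr; exact h₁ x
    _ = _ := by simp; ring

lemma factorial_le_card_permsWithBad (R : X → X → Prop) (d : ℕ) (hd : 100 * d ≤ Fintype.card X)
    (h₁ : ∀ x, #{y | ¬ R x y} ≤ d) (h₂ : ∀ y, #{x | ¬ R x y} ≤ d) :
    ((Fintype.card X)! : ℝ) ≤ 2 * Real.exp (Fintype.card X) * #(permsWithBad R 0) := by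
  set N := Fintype.card X with hN
  let L : Finset (Perm X) := {σ | N < 2 * numBad R σ}
  have hL : 2 * #L ≤ N ! := by
    rcases Nat.eq_zero_or_pos N with h0 | hpos
    · have : IsEmpty X := Fintype.card_eq_zero_iff.mp h0
      simp [L, numBad]
    have hm : #L * N ≤ 2 * (d * N !) := by
      calc _ ≤ ∑ σ ∈ L, 2 * numBad R σ := by
            rw [← smul_eq_mul]
            exact card_nsmul_le_sum _ _ _ fun σ hσ => (mem_filter.mp hσ).2.le
        _ ≤ ∑ σ, 2 * numBad R σ := sum_le_sum_of_subset (subset_univ _)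
        _ ≤ _ := by rw [← mul_sum]; gcongr; exact sum_numBad_le R d h₁
    refine Nat.le_of_mul_le_mul_right (c := N) ?_ hpos
    nlinarith [Nat.zero_le (N !), Nat.mul_le_mul_right (N !) hd]
  have hcover : N ! ≤ #L + ∑ j ∈ range (N / 2 + 1), #(permsWithBad R j) := by
    rw [hN, ← Fintype.card_perm, ← card_univ, ← hN]
    refine le_trans (card_le_card ?_)
      ((card_union_le L ((range (N / 2 + 1)).biUnion (permsWithBad R))).trans
        (Nat.add_le_add_left card_biUnion_le _))
    intro σ _
    simp only [L, permsWithBad, mem_union, mem_filter, mem_univ, true_and, mem_biUnion, mem_range,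
      exists_eq_right']
    omega
  have hsum : ((∑ j ∈ range (N / 2 + 1), #(permsWithBad R j) : ℕ) : ℝ) ≤
      Real.exp N * #(permsWithBad R 0) := by
    calc _ ≤ ∑ j ∈ range (N / 2 + 1), (#(permsWithBad R 0) : ℝ) * ((N : ℝ) ^ j / j !) := by
          push_cast
          refine sum_le_sum fun j hj => ?_
          rw [mem_range] at hj
          have := card_permsWithBad_le R d hd h₁ h₂ j (by omega)
          rw [← mul_div_assoc, le_div_iff₀ (by positivity)]
          exact_mod_cast this
      _ ≤ #(permsWithBad R 0) * Real.exp N := by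
          rw [← mul_sum]
          gcongr
          exact Real.sum_le_exp_of_nonneg (by positivity) _
      _ = _ := mul_comm _ _
  have hL' : (2 * #L : ℝ) ≤ N ! := by exact_mod_cast hL
  have hc' : (N ! : ℝ) ≤ #L + ((∑ j ∈ range (N / 2 + 1), #(permsWithBad R j) : ℕ) : ℝ) := by
    exact_mod_cast hcover
  linarith

/-- The uniform random permutation compatible with a dense relation is spread. -/
lemma card_permsThrough_mul_pow_card_le (R : X → X → Prop) (d : ℕ)
    (hd : 100 * d ≤ Fintype.card X) (h₁ : ∀ x, #{y | ¬ R x y} ≤ d)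
    (h₂ : ∀ y, #{x | ¬ R x y} ≤ d) (c : X → X) (T : Finset X) :
    (#(permsThrough R T c) : ℝ) * (Fintype.card X : ℝ) ^ #T ≤
      (6 * Real.exp 4) ^ #T * #(permsWithBad R 0) := by
  set N := Fintype.card X with hN
  have he : 1 ≤ Real.exp 4 := Real.one_le_exp (by norm_num)
  by_cases hs : 3 * #T ≤ N
  · have h := card_permsThrough_mul_pow R d ((N + 1) / 2) h₁ h₂ c T (by omega)
    rw [permsThrough_empty] at h
    have h' : (#(permsThrough R T c) : ℝ) * (((N + 1) / 2 : ℕ) : ℝ) ^ #T ≤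
        #(permsWithBad R 0) := by exact_mod_cast h
    have hhalf : (N : ℝ) ≤ 2 * (((N + 1) / 2 : ℕ) : ℝ) := by
      exact_mod_cast (by omega : N ≤ 2 * ((N + 1) / 2))
    calc _ ≤ (#(permsThrough R T c) : ℝ) * (2 * (((N + 1) / 2 : ℕ) : ℝ)) ^ #T := by gcongr
      _ = 2 ^ #T * ((#(permsThrough R T c) : ℝ) * (((N + 1) / 2 : ℕ) : ℝ) ^ #T) := by
        rw [mul_pow]; ring
      _ ≤ (6 * Real.exp 4) ^ #T * #(permsWithBad R 0) := by
        gcongr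
        linarith
  · push Not at hs
    set s := #T with hsT
    have hs0 : s ≠ 0 := by omega
    have hfac : (#(permsThrough R T c) : ℝ) * s ! ≤ N ! := by
      exact_mod_cast card_permsThrough_mul_factorial R c T
    have hNfac := factorial_le_card_permsWithBad R d hd h₁ h₂
    have hpow : (s : ℝ) ^ s ≤ Real.exp s * s ! := by
      have := Real.pow_div_factorial_le_exp (s : ℝ) (by positivity) s
      rwa [div_le_iff₀ (by positivity)] at this
    have hNs : (N : ℝ) ≤ 3 * s := by exact_mod_cast hs.le
    calc _ ≤ (#(permsThrough R T c) : ℝ) * (3 * s) ^ s := by gcongr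
      _ = 3 ^ s * (#(permsThrough R T c) * (s : ℝ) ^ s) := by rw [mul_pow]; ring
      _ ≤ 3 ^ s * (#(permsThrough R T c) * (Real.exp s * s !)) := by gcongr
      _ = 3 ^ s * Real.exp s * (#(permsThrough R T c) * s !) := by ring
      _ ≤ 3 ^ s * Real.exp s * (2 * Real.exp N * #(permsWithBad R 0)) :=
        mul_le_mul_of_nonneg_left (hfac.trans hNfac) (by positivity)
      _ ≤ 3 ^ s * Real.exp s * (2 ^ s * Real.exp (3 * s) * #(permsWithBad R 0)) := by
        gcongr
        exact le_self_pow₀ (by norm_num) hs0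
      _ = (6 * Real.exp 4) ^ s * #(permsWithBad R 0) := by
        rw [show (6 : ℝ) * Real.exp 4 = 3 * 2 * (Real.exp 1 * Real.exp 3) by
          rw [← Real.exp_add]; norm_num, mul_pow, mul_pow, mul_pow, ← Real.exp_nat_mul,
          ← Real.exp_nat_mul, mul_one, mul_comm (s : ℝ) 3]
        ring

/-- If at least 99% of the elements satisfy `p`, then at most 1% do not. -/
lemma card_not_le_of_le_natCard {Y : Type*} [Fintype Y] (p : Y → Prop)
    (h : (99 : ℝ) / 100 * Fintype.card Y ≤ Nat.card {y // p y}) :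
    100 * #{y | ¬ p y} ≤ Fintype.card Y := by
  rw [Nat.card_eq_fintype_card, Fintype.card_subtype] at h
  have hsum : #{y | p y} + #{y | ¬ p y} = Fintype.card Y := by
    rw [card_filter_add_card_filter_not, card_univ]
  have hsum' : (#{y | p y} : ℝ) + #{y | ¬ p y} = Fintype.card Y := by exact_mod_cast hsum
  have : (100 * #{y | ¬ p y} : ℝ) ≤ Fintype.card Y := by linarith
  exact_mod_cast this

/-- The star matching obtained from a permutation of `B` by contracting the `k` copies of each
centre. -/
def starMatching {A B : Type*} {k : ℕ} (E : A → B → Prop) (e : B ≃ A × Fin k)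
    (σ : {σ : Perm B // ∀ b, E (e (σ b)).1 b}) :
    {g : B → A // (∀ b, E (g b) b) ∧ ∀ a, Nat.card {b : B // g b = a} = k} :=
  ⟨fun b => (e (σ.1 b)).1, σ.2, fun a => by
    let f : {b : B // (e (σ.1 b)).1 = a} ≃ Fin k :=
      { toFun := fun b => (e (σ.1 b.1)).2
        invFun := fun i => ⟨σ.1.symm (e.symm (a, i)), by simp⟩
        left_inv := by rintro ⟨b, rfl⟩; simp
        right_inv := fun i => by simp }
    rw [Nat.card_congr f, Nat.card_eq_fintype_card, Fintype.card_fin]⟩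

lemma card_starMatching_event_le {A B : Type*} [Fintype B] {k : ℕ} (E : A → B → Prop)
    (e : B ≃ A × Fin k) (d : ℕ) (hd : 100 * d ≤ Fintype.card B)
    (h₁ : ∀ x, #{y | ¬ E (e y).1 x} ≤ d) (h₂ : ∀ y, #{x | ¬ E (e y).1 x} ≤ d)
    (s : ℕ) (a : Fin s → A) (b : Fin s → B) (hb : Function.Injective b) :
    (#{σ : Perm B | (∀ x, E (e (σ x)).1 x) ∧ ∀ i, (e (σ (b i))).1 = a i} : ℝ) *
      (Fintype.card B : ℝ) ^ s ≤ (k * (6 * Real.exp 4)) ^ s *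
        #(permsWithBad (fun x y => E (e y).1 x) 0) := by
  let R : B → B → Prop := fun x y => E (e y).1 x
  let c (f : Fin s → Fin k) : B → B := Function.extend b (fun i => e.symm (a i, f i)) id
  let T : Finset B := univ.image b
  have hT : #T = s := by rw [card_image_of_injective _ hb, card_fin]
  have hsub : ({σ : Perm B | (∀ x, E (e (σ x)).1 x) ∧ ∀ i, (e (σ (b i))).1 = a i} :
      Finset (Perm B)) ⊆ univ.biUnion fun f : Fin s → Fin k => permsThrough R T (c f) := by
    intro σ hσ
    simp only [mem_filter, mem_univ, true_and] at hσ
    simp only [mem_biUnion, mem_univ, true_and, permsThrough, mem_filter, T, mem_image,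
      forall_exists_index, forall_apply_eq_imp_iff]
    refine ⟨fun i => (e (σ (b i))).2, hσ.1, fun i => ?_⟩
    simp only [c]
    rw [hb.extend_apply, ← hσ.2 i]
    simp
  have hcard := (card_le_card hsub).trans card_biUnion_le
  have hcard' : (#{σ : Perm B | (∀ x, E (e (σ x)).1 x) ∧ ∀ i, (e (σ (b i))).1 = a i} : ℝ) ≤
      ∑ f : Fin s → Fin k, (#(permsThrough R T (c f)) : ℝ) := by exact_mod_cast hcard
  calc _ ≤ (∑ f : Fin s → Fin k, (#(permsThrough R T (c f)) : ℝ)) * (Fintype.card B : ℝ) ^ s := by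
        gcongr
    _ ≤ ∑ f : Fin s → Fin k, (6 * Real.exp 4) ^ s * (#(permsWithBad R 0) : ℝ) := by
        rw [sum_mul]
        refine sum_le_sum fun f _ => ?_
        have h := card_permsThrough_mul_pow_card_le R d hd h₁ h₂ (c f) T
        rwa [hT] at h
    _ = _ := by
        rw [sum_const, card_univ, Fintype.card_fun, Fintype.card_fin, Fintype.card_fin,
          nsmul_eq_mul]
        push_cast
        rw [mul_pow]
        ring

end SpreadStarMatching


/-- spread star matchings.
There is an absolute constant `C > 0` such that for every `k` there is `n₀` with:
for all `n ≥ n₀`, if `G` is a bipartite graph with parts `A`, `B`, `|A| = n`,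
`|B| = kn`, every `a ∈ A` has `deg(a,B) ≥ (99/100)|B|` and every `b ∈ B` has
`deg(b,A) ≥ (99/100)|A|`, then there is a random perfect `K_{1,k}`-matching `M`
(encoded as a map `g : B → A` matching each `b` to the centre of its star, each
centre having exactly `k` leaves), such that for any distinct edges `e₁,…,e_s`
the probability that all belong to `M` is at most `(C/n)^s`. -/
theorem stmt_3 :
    ∃ C : ℝ, 0 < C ∧ ∀ k : ℕ, ∃ n₀ : ℕ, ∀ n : ℕ, n₀ ≤ n →
      ∀ (A B : Type) [Fintype A] [Fintype B] (E : A → B → Prop),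
        Fintype.card A = n → Fintype.card B = k * n →
        (∀ a : A, (99 : ℝ) / 100 * (Fintype.card B) ≤ (Nat.card {b : B // E a b} : ℝ)) →
        (∀ b : B, (99 : ℝ) / 100 * (Fintype.card A) ≤ (Nat.card {a : A // E a b} : ℝ)) →
        ∃ μ : PMF {g : B → A //
            (∀ b, E (g b) b) ∧ ∀ a, Nat.card {b : B // g b = a} = k},
          ∀ (s : ℕ) (a : Fin s → A) (b : Fin s → B),
            (∀ i, E (a i) (b i)) →
            Function.Injective (fun i => (a i, b i)) →
            μ.toOuterMeasure {g | ∀ i, g.1 (b i) = a i} ≤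
              ENNReal.ofReal ((C / n) ^ s) := by
  classical
  refine ⟨6 * Real.exp 4, by positivity, fun k => ⟨1, fun n hn A B _ _ E hA hB hdA hdB => ?_⟩⟩
  let e : B ≃ A × Fin k := Fintype.equivOfCardEq (by simp [hA, hB, mul_comm])
  let R : B → B → Prop := fun x y => E (e y).1 x
  let d := Fintype.card B / 100
  have hd : 100 * d ≤ Fintype.card B := Nat.mul_div_le _ _
  have h₁ (x : B) : (Finset.univ.filter fun y => ¬ R x y).card ≤ d := by
    have hx := card_not_le_of_le_natCard (fun a => E a x) (hdB x)
    have : (Finset.univ.filter fun y => ¬ R x y).card =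
        (Finset.univ.filter fun a => ¬ E a x).card * k := by
      calc _ = ((Finset.univ.filter fun a => ¬ E a x) ×ˢ (Finset.univ : Finset (Fin k))).card :=
            Finset.card_bij (fun y _ => e y) (by simp [R]) (by simp)
              fun p hp => ⟨e.symm p, by simpa [R] using hp, by simp⟩
        _ = _ := by simp
    rw [this, Nat.le_div_iff_mul_le (by norm_num), hB, ← hA]
    nlinarith
  have h₂ (y : B) : (Finset.univ.filter fun x => ¬ R x y).card ≤ d := by
    have hy := card_not_le_of_le_natCard (fun b => E (e y).1 b) (hdA (e y).1)
    rw [Nat.le_div_iff_mul_le (by norm_num), mul_comm]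
    exact hy
  have hP : 0 < (permsWithBad R 0).card := by
    have h := factorial_le_card_permsWithBad R d hd h₁ h₂
    by_contra h0
    rw [Nat.eq_zero_of_not_pos h0] at h
    simp [(Nat.factorial_pos _).ne'] at h
  have hcardΩ : Fintype.card {σ : Equiv.Perm B // ∀ b, E (e (σ b)).1 b} =
      (permsWithBad R 0).card := by
    rw [← permsThrough_empty R id, Fintype.card_subtype]
    simp [permsThrough, R]
  have : Nonempty {σ : Equiv.Perm B // ∀ b, E (e (σ b)).1 b} :=
    Fintype.card_pos_iff.mp (hcardΩ ▸ hP)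
  refine ⟨(PMF.uniformOfFintype _).map (starMatching E e), fun s a b _ hinj => ?_⟩
  by_cases hb : Function.Injective b
  · rw [PMF.toOuterMeasure_map_apply, PMF.toOuterMeasure_uniformOfFintype_apply, hcardΩ]
    have hev := card_starMatching_event_le E e d hd h₁ h₂ s a b hb
    set m := (Finset.univ.filter fun σ : Equiv.Perm B =>
      (∀ x, E (e (σ x)).1 x) ∧ ∀ i, (e (σ (b i))).1 = a i).card with hm
    have hcard : Fintype.card (starMatching E e ⁻¹' {g | ∀ i, g.1 (b i) = a i}) = m := by
      rw [hm, ← Fintype.card_subtype]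
      exact Fintype.card_congr ((Equiv.subtypeEquivRight fun σ => Iff.rfl).trans
        (Equiv.subtypeSubtypeEquivSubtypeInter (fun σ : Equiv.Perm B => ∀ x, E (e (σ x)).1 x)
          fun σ => ∀ i, (e (σ (b i))).1 = a i))
    rw [hcard]
    have hreal : (m : ℝ) / (permsWithBad R 0).card ≤ (6 * Real.exp 4 / n) ^ s := by
      have hP' : (0 : ℝ) < (permsWithBad R 0).card := by exact_mod_cast hP
      rw [div_le_iff₀ hP']
      have hn' : (0 : ℝ) < n := by exact_mod_cast hn
      rcases Nat.eq_zero_or_pos s with rfl | hs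
      · simpa using hev
      have hk : 0 < k := by
        refine Nat.pos_of_ne_zero fun hk => ?_
        have : 0 < Fintype.card B := Fintype.card_pos_iff.mpr ⟨b ⟨0, hs⟩⟩
        simp [hB, hk] at this
      have hk' : (0 : ℝ) < k := by exact_mod_cast hk
      rw [hB, Nat.cast_mul, mul_pow, mul_pow] at hev
      rw [div_pow, div_mul_eq_mul_div, le_div_iff₀ (by positivity)]
      refine le_of_mul_le_mul_left ?_ (by positivity : (0 : ℝ) < k ^ s)
      linarith
    calc (m : ENNReal) / (permsWithBad R 0).card
        = ENNReal.ofReal ((m : ℝ) / (permsWithBad R 0).card) := by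
          rw [ENNReal.ofReal_div_of_pos (by exact_mod_cast hP), ENNReal.ofReal_natCast,
            ENNReal.ofReal_natCast]
      _ ≤ _ := ENNReal.ofReal_le_ofReal hreal
  · have hempty : {g : {g : B → A // (∀ b, E (g b) b) ∧ ∀ a, Nat.card {b : B // g b = a} = k} |
        ∀ i, g.1 (b i) = a i} = ∅ := by
      refine Set.eq_empty_of_forall_notMem fun g hg => hb fun i j hij => hinj ?_
      have hg' : ∀ i, g.1 (b i) = a i := hg
      simp only [Prod.mk.injEq]
      exact ⟨by rw [← hg' i, ← hg' j, hij], hij⟩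
    rw [hempty]
    simp
end

section
/- For every η ∈ (0,1] there exists γ₀ > 0 such that for every 0 < γ ≤ γ₀ there exists n₀ ∈ ℕ such that the following holds for all n ≥ n₀. Let G be a graph on n vertices, let v ∈ V(G), and let V₁ ∪ … ∪ V_k be a partition of V(G) \ {v} such that |V_i| ≥ ηn for all i ∈ [k] and, for every i ∈ [k] and every u ∈ V(G), deg(u, V_i) ≥ (1-γ)|V_i|. Let T be a tree, let t ∈ V(T), and let c : V(T) \ {t} → [k] be a colouring such that for each i ∈ [k] the number of vertices of colour i is at most (1-η)|V_i|. Then there exists a random embedding φ of T into G such that: (1) φ(t) = v with probability 1; (2) with probability 1, every vertex of T \ {t} of colour i is embedded into V_i; and (3) the restriction of φ to V(T) \ {t} is (2/(η²n))-spread. -/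
open Finset

/-- In a tree rooted at `t`, every other vertex has a parent closer to `t`, and every edge joins
a vertex to its parent. -/
lemma SimpleGraph.IsTree.exists_parent {W : Type*} {T : SimpleGraph W} (hT : T.IsTree) (t : W) :
    ∃ par : W → W, (∀ w, w ≠ t → T.dist t (par w) < T.dist t w) ∧
      ∀ a b, T.Adj a b → (a ≠ t ∧ par a = b) ∨ (b ≠ t ∧ par b = a) := by
  have key : ∀ w, ∃ p, w ≠ t → T.Adj p w ∧ T.dist t p + 1 = T.dist t w := by
    intro w
    by_cases hw : w = t
    · exact ⟨t, fun h => absurd hw h⟩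
    obtain ⟨q, hq⟩ := hT.connected.exists_walk_length_eq_dist t w
    have hnil : ¬ q.Nil := fun h => hw h.eq.symm
    have hadj := q.adj_penultimate hnil
    refine ⟨q.penultimate, fun _ => ⟨hadj, ?_⟩⟩
    have h₁ := T.dist_le q.dropLast
    have h₂ : q.dropLast.length + 1 = q.length := q.length_dropLast_add_one hnil
    have h₃ := hT.dist_eq_dist_add_one_of_adj t hadj
    lia
  choose par hpar using key
  have uniq : ∀ a b, T.Adj a b → T.dist t b = T.dist t a + 1 → b ≠ t ∧ par b = a := by
    intro a b hab hd
    have hb : b ≠ t := by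
      rintro rfl
      simp at hd
    refine ⟨hb, ?_⟩
    obtain ⟨hadj, hd'⟩ := hpar b hb
    obtain ⟨p, hp⟩ := hT.connected.exists_walk_length_eq_dist t a
    obtain ⟨q, hq⟩ := hT.connected.exists_walk_length_eq_dist t (par b)
    have hp' : (p.concat hab).IsPath :=
      (p.concat hab).isPath_of_length_eq_dist (by simp; lia)
    have hq' : (q.concat hadj).IsPath :=
      (q.concat hadj).isPath_of_length_eq_dist (by simp; lia)
    have h := congrArg SimpleGraph.Walk.penultimate ((hT.existsUnique_path t b).unique hq' hp')
    simpa using h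
  refine ⟨par, fun w hw => by have := (hpar w hw).2; lia, fun a b hab => ?_⟩
  rcases hT.dist_eq_dist_add_one_of_adj t hab with h | h
  · exact .inl (uniq b a hab.symm h)
  · exact .inr (uniq a b hab h)

/-- Resampling the value at `w` of a random function with conditional point probabilities at most
`q` multiplies the probability of prescribing the values on `insert w A` by at most `q`. -/
lemma PMF.toOuterMeasure_bind_update_le {W V : Type*} [DecidableEq W] (μ : PMF (W → V)) (w : W)
    (ν : (W → V) → PMF V) {q : ENNReal} (hν : ∀ f y, ν f y ≤ q) (g : W → V) (A : Finset W)
    (hw : w ∉ A) :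
    (μ.bind fun f => (ν f).map (Function.update f w)).toOuterMeasure
        {f | ∀ a ∈ insert w A, f a = g a} ≤
      μ.toOuterMeasure {f | ∀ a ∈ A, f a = g a} * q := by
  rw [PMF.toOuterMeasure_bind_apply, PMF.toOuterMeasure_apply, ← ENNReal.tsum_mul_right]
  refine ENNReal.tsum_le_tsum fun f => ?_
  rw [PMF.toOuterMeasure_map_apply]
  have hne : ∀ a ∈ A, a ≠ w := fun a ha => ne_of_mem_of_not_mem ha hw
  by_cases hf : ∀ a ∈ A, f a = g a
  · rw [Set.indicator_of_mem (by exact hf)]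
    gcongr
    refine (MeasureTheory.measure_mono (t := {g w}) ?_).trans
      ((PMF.toOuterMeasure_apply_singleton _ _).trans_le (hν f _))
    intro y hy
    simpa using hy w (mem_insert_self w A)
  · rw [Set.indicator_of_notMem (by exact hf), zero_mul]
    refine le_of_eq (mul_eq_zero_of_right _ ?_)
    rw [PMF.toOuterMeasure_apply_eq_zero_iff, Set.disjoint_right]
    intro y hy
    refine absurd (fun a ha => ?_) hf
    simpa [hne a ha] using hy a (mem_insert_of_mem ha)

/-- Resampling the value at `w` does not affect the values elsewhere. -/
lemma PMF.toOuterMeasure_bind_update_of_notMem {W V : Type*} [DecidableEq W] (μ : PMF (W → V))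
    (w : W) (ν : (W → V) → PMF V) (g : W → V) (A : Finset W) (hw : w ∉ A) :
    (μ.bind fun f => (ν f).map (Function.update f w)).toOuterMeasure {f | ∀ a ∈ A, f a = g a} =
      μ.toOuterMeasure {f | ∀ a ∈ A, f a = g a} := by
  rw [PMF.toOuterMeasure_bind_apply, PMF.toOuterMeasure_apply]
  refine tsum_congr fun f => ?_
  rw [PMF.toOuterMeasure_map_apply]
  have hpre : ∀ y, (∀ a ∈ A, Function.update f w y a = g a) ↔ ∀ a ∈ A, f a = g a := fun y =>
    forall₂_congr fun a ha => by
      rw [Function.update_of_ne (ne_of_mem_of_not_mem ha hw)]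
  by_cases hf : ∀ a ∈ A, f a = g a
  · have h : (ν f).toOuterMeasure (Function.update f w ⁻¹' {f | ∀ a ∈ A, f a = g a}) = 1 :=
      (PMF.toOuterMeasure_apply_eq_one_iff _ _).2 fun y _ => (hpre y).2 hf
    rw [Set.indicator_of_mem (by exact hf), h, mul_one]
  · rw [Set.indicator_of_notMem (by exact hf), mul_eq_zero]
    right
    rw [PMF.toOuterMeasure_apply_eq_zero_iff, Set.disjoint_right]
    exact fun y hy => absurd ((hpre y).1 hy) hf

/-- Random greedy embedding: if for every partial assignment every vertex `w ≠ t` has at least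
`q⁻¹` admissible images in its class `P (c w)`, then choosing images uniformly at random, parents
before children, gives a `q`-spread random assignment. -/
lemma exists_spread_greedy {W V ι : Type*} [DecidableEq W] [DecidableEq V] (G : SimpleGraph V)
    [DecidableRel G.Adj] [DecidableEq ι]
    (P : ι → Finset V) (hP : ∀ i j, i ≠ j → Disjoint (P i) (P j)) (v : V) (t : W)
    (c : W → ι) (par : W → W) (d : W → ℕ)
    (hd : ∀ w, w ≠ t → d (par w) < d w) {q : ENNReal} (hq : q ≠ ⊤)
    (hcand : ∀ (s : Finset W) (w : W) (f : W → V), t ∉ s → w ∉ s → w ≠ t →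
      q⁻¹ ≤ (#({y ∈ P (c w) | G.Adj (f (par w)) y} \ {x ∈ s | c x = c w}.image f) : ENNReal))
    (s : Finset W) (hts : t ∉ s) (hs : ∀ w ∈ s, par w = t ∨ par w ∈ s) :
    ∃ μ : PMF (W → V),
      (∀ f ∈ μ.support, f t = v ∧ (∀ w ∈ s, f w ∈ P (c w)) ∧
        (∀ w ∈ s, G.Adj (f (par w)) (f w)) ∧ Set.InjOn f s) ∧
      ∀ (g : W → V) (A : Finset W), A ⊆ s →
        μ.toOuterMeasure {f | ∀ a ∈ A, f a = g a} ≤ q ^ #A := by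
  induction s using Finset.induction_on_max_value d with
  | empty =>
    refine ⟨PMF.pure fun _ => v, by simp, fun g A hA => ?_⟩
    obtain rfl : A = ∅ := subset_empty.1 hA
    simp
  | insert w s hws hmax ih =>
    have hwt : w ≠ t := fun h => hts (h ▸ mem_insert_self w s)
    have hts' : t ∉ s := fun h => hts (mem_insert_of_mem h)
    have hparne : ∀ x ∈ insert w s, par x ≠ w := by
      intro x hx h
      have h₁ := hd x (fun h => hts (h ▸ hx))
      have h₂ : d x ≤ d w := by
        rcases mem_insert.1 hx with rfl | hx
        exacts [le_rfl, hmax x hx]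
      rw [h] at h₁
      lia
    obtain ⟨μ, hμ, hspread⟩ := ih hts' fun x hx =>
      (hs x (mem_insert_of_mem hx)).imp_right fun h =>
        (mem_insert.1 h).resolve_left (hparne x (mem_insert_of_mem hx))
    set C : (W → V) → Finset V := fun f =>
      {y ∈ P (c w) | G.Adj (f (par w)) y} \ {x ∈ s | c x = c w}.image f with hC
    have hCcard : ∀ f, q⁻¹ ≤ (#(C f) : ENNReal) := fun f => hcand s w f hts' hws hwt
    have hCne : ∀ f, (C f).Nonempty := fun f => by
      have h := (ENNReal.inv_pos.2 hq).trans_le (hCcard f)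
      exact card_pos.1 (by exact_mod_cast h)
    set ν : (W → V) → PMF V := fun f => PMF.uniformOfFinset (C f) (hCne f) with hνdef
    have hν : ∀ f y, ν f y ≤ q := by
      intro f y
      rw [hνdef, PMF.uniformOfFinset_apply]
      split_ifs
      · exact ENNReal.inv_le_iff_inv_le.2 (hCcard f)
      · exact zero_le
    refine ⟨μ.bind fun f => (ν f).map (Function.update f w), ?_, ?_⟩
    · intro f' hf'
      obtain ⟨f, hf, hf'⟩ := (PMF.mem_support_bind_iff _ _ _).1 hf'
      obtain ⟨y, hy, rfl⟩ := (PMF.mem_support_map_iff _ _ _).1 hf'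
      rw [hνdef, PMF.mem_support_uniformOfFinset_iff, hC, mem_sdiff, mem_filter] at hy
      obtain ⟨⟨hyP, hyadj⟩, hyimg⟩ := hy
      obtain ⟨hft, hfP, hfadj, hfinj⟩ := hμ f hf
      have hne : ∀ x ∈ s, x ≠ w := fun x hx h => hws (h ▸ hx)
      have hyne : ∀ x ∈ s, f x ≠ y := by
        intro x hx hxy
        by_cases hc : c x = c w
        · exact hyimg (mem_image.2 ⟨x, mem_filter.2 ⟨hx, hc⟩, hxy⟩)
        · exact Finset.disjoint_left.1 (hP _ _ hc) (hfP x hx) (hxy ▸ hyP)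
      refine ⟨by rw [Function.update_of_ne hwt.symm, hft], ?_, ?_, ?_⟩
      · intro x hx
        rcases mem_insert.1 hx with rfl | hx
        · simpa using hyP
        · simpa [hne x hx] using hfP x hx
      · intro x hx
        rw [Function.update_of_ne (hparne x hx)]
        rcases mem_insert.1 hx with rfl | hx
        · simpa using hyadj
        · simpa [hne x hx] using hfadj x hx
      · rw [coe_insert, Set.injOn_insert (by simpa using hws)]
        have heq : Set.EqOn f (Function.update f w y) s := fun x hx =>
          (Function.update_of_ne (hne x hx) _ _).symm
        refine ⟨hfinj.congr heq, ?_⟩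
        rintro ⟨x, hx, hxy⟩
        rw [Function.update_self, ← heq hx] at hxy
        exact hyne x hx hxy
    · intro g A hA
      by_cases hwA : w ∈ A
      · have hA' : A.erase w ⊆ s := fun x hx =>
          (mem_insert.1 (hA (mem_of_mem_erase hx))).resolve_left (ne_of_mem_erase hx)
        have h := PMF.toOuterMeasure_bind_update_le μ w ν hν g (A.erase w) (notMem_erase w A)
        rw [insert_erase hwA] at h
        refine h.trans ?_
        rw [← card_erase_add_one hwA, pow_succ]
        gcongr
        exact hspread g _ hA'
      · rw [PMF.toOuterMeasure_bind_update_of_notMem μ w ν g A hwA]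
        exact hspread g A ((subset_insert_iff_of_notMem hwA).1 hA)

/-- A random function supported on functions with property `p` can be regarded as a random element
of the subtype. -/
lemma PMF.exists_subtype {α : Type*} (μ : PMF α) (p : α → Prop) (hp : ∀ a ∈ μ.support, p a) :
    ∃ μ' : PMF {a // p a}, ∀ S : Set α,
      μ'.toOuterMeasure {a | a.1 ∈ S} = μ.toOuterMeasure S := by
  classical
  obtain ⟨a₀, ha₀⟩ := μ.support_nonempty
  refine ⟨μ.map fun a => if h : p a then ⟨a, h⟩ else ⟨a₀, hp a₀ ha₀⟩, fun S => ?_⟩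
  rw [PMF.toOuterMeasure_map_apply]
  refine PMF.toOuterMeasure_apply_eq_of_inter_support_eq _ ?_
  ext a
  simp only [Set.mem_inter_iff, Set.mem_preimage, Set.mem_ofPred_eq, and_congr_left_iff]
  intro ha
  rw [dif_pos (hp a ha)]


/-- coloured spread embedding into a near-complete partitioned graph.
For every `η ∈ (0,1]` there is `γ₀ > 0` such that for all `0 < γ ≤ γ₀` there is `n₀`
such that for all `n ≥ n₀` the following holds. Let `G` be an `n`-vertex graph,
`v ∈ V(G)`, and let `V₁ ∪ ⋯ ∪ V_k` partition `V(G) \ {v}` with `|V_i| ≥ ηn` and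
`deg(u, V_i) ≥ (1-γ)|V_i|` for all `u, i`. Let `T` be a tree, `t ∈ V(T)`, and let
`c` colour `V(T) \ {t}` so that at most `(1-η)|V_i|` vertices get colour `i`. Then
there is a random embedding `φ : T → G` with `φ(t) = v` a.s., every `i`-coloured
vertex landing in `V_i` a.s., whose restriction to `V(T) \ {t}` is `(2/(η²n))`-spread. -/
theorem stmt_4 (η : ℝ) (hη0 : 0 < η) (hη1 : η ≤ 1) :
    ∃ γ₀ : ℝ, 0 < γ₀ ∧ ∀ γ : ℝ, 0 < γ → γ ≤ γ₀ →
      ∃ n₀ : ℕ, ∀ n : ℕ, n₀ ≤ n →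
        ∀ (V : Type) [Fintype V] [DecidableEq V], Fintype.card V = n →
        ∀ (G : SimpleGraph V) (v : V) (k : ℕ) (P : Fin k → Finset V),
          (∀ i j, i ≠ j → Disjoint (P i) (P j)) →
          (Finset.univ.biUnion P = Finset.univ.erase v) →
          (∀ i, η * n ≤ ((P i).card : ℝ)) →
          (∀ i, ∀ u : V,
            (1 - γ) * ((P i).card : ℝ) ≤ (Nat.card {w : V // w ∈ P i ∧ G.Adj u w} : ℝ)) →
        ∀ (W : Type) [Fintype W] (T : SimpleGraph W), T.IsTree →
        ∀ (t : W) (c : W → Fin k),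
          (∀ i, (Nat.card {w : W // w ≠ t ∧ c w = i} : ℝ) ≤ (1 - η) * ((P i).card : ℝ)) →
          ∃ μ : PMF {f : W → V //
              Function.Injective f ∧ ∀ a b, T.Adj a b → G.Adj (f a) (f b)},
            μ.toOuterMeasure {f | f.1 t = v} = 1 ∧
            μ.toOuterMeasure {f | ∀ w, w ≠ t → f.1 w ∈ P (c w)} = 1 ∧
            ∀ (s : ℕ) (x : Fin s → W) (y : Fin s → V),
              (∀ i, x i ≠ t) →
              Function.Injective x → Function.Injective y →
              μ.toOuterMeasure {f | ∀ i, f.1 (x i) = y i} ≤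
                ENNReal.ofReal ((2 / (η ^ 2 * n)) ^ s) := by
  classical
  refine ⟨η / 2, by positivity, fun γ _ hγ => ⟨0, fun n _ V _ _ hn G v k P hdisj hcover hsize hdeg
    W _ T hT t c hcol => ?_⟩⟩
  have hn0 : (0 : ℝ) < n := by
    have : 0 < Fintype.card V := Fintype.card_pos_iff.2 ⟨v⟩
    exact_mod_cast hn ▸ this
  have hv : ∀ i, v ∉ P i := fun i hi => by
    have h : v ∈ Finset.univ.biUnion P := mem_biUnion.2 ⟨i, mem_univ i, hi⟩
    rw [hcover] at h
    exact notMem_erase v _ h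
  obtain ⟨par, hpar, hedge⟩ := hT.exists_parent t
  have hcand : ∀ (s : Finset W) (w : W) (f : W → V), t ∉ s → w ∉ s → w ≠ t →
      (ENNReal.ofReal (2 / (η ^ 2 * n)))⁻¹ ≤
        (#({y ∈ P (c w) | G.Adj (f (par w)) y} \ {x ∈ s | c x = c w}.image f) : ENNReal) := by
    intro s w f hts _ _
    rw [← ENNReal.ofReal_inv_of_pos (by positivity), ← ENNReal.ofReal_natCast]
    refine ENNReal.ofReal_le_ofReal ?_
    have hd := hdeg (c w) (f (par w))
    have hc := hcol (c w)
    have hsz := hsize (c w)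
    rw [Nat.card_eq_fintype_card, Fintype.card_subtype, ← filter_filter, filter_mem_eq_inter,
      univ_inter] at hd
    rw [Nat.card_eq_fintype_card, Fintype.card_subtype] at hc
    have hused : #({x ∈ s | c x = c w}.image f) ≤ #{x : W | x ≠ t ∧ c x = c w} := by
      refine card_image_le.trans (card_le_card fun x hx => ?_)
      obtain ⟨hxs, hxc⟩ := mem_filter.1 hx
      exact mem_filter.2 ⟨mem_univ x, fun h => hts (h ▸ hxs), hxc⟩
    have hsub := le_card_sdiff ({x ∈ s | c x = c w}.image f)
      {y ∈ P (c w) | G.Adj (f (par w)) y}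
    have hsub' : (#{y ∈ P (c w) | G.Adj (f (par w)) y} : ℝ) ≤
        #({y ∈ P (c w) | G.Adj (f (par w)) y} \ {x ∈ s | c x = c w}.image f) +
          #{x : W | x ≠ t ∧ c x = c w} := by
      exact_mod_cast (by lia)
    rw [inv_div]
    nlinarith
  obtain ⟨μ, hμ, hspread⟩ := exists_spread_greedy G P hdisj v t c par (T.dist t) hpar
    ENNReal.ofReal_ne_top hcand (univ.erase t) (notMem_erase t _)
    fun w _ => or_iff_not_imp_left.2 fun h => mem_erase.2 ⟨h, mem_univ _⟩
  simp only [mem_erase, mem_univ, and_true] at hμ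
  have hemb : ∀ f ∈ μ.support,
      Function.Injective f ∧ ∀ a b, T.Adj a b → G.Adj (f a) (f b) := by
    intro f hf
    obtain ⟨hft, hfP, hfadj, hfinj⟩ := hμ f hf
    have hne : ∀ w, w ≠ t → f w ≠ f t := fun w hw h => hv (c w) (hft ▸ h ▸ hfP w hw)
    refine ⟨fun a b hab => ?_, fun a b hab => ?_⟩
    · by_cases ha : a = t
      · subst ha
        by_contra hb
        exact hne b (Ne.symm hb) hab.symm
      · by_cases hb : b = t
        · subst hb
          exact absurd hab (hne a ha)
        · exact hfinj (by simpa using ha) (by simpa using hb) hab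
    · rcases hedge a b hab with ⟨ha, rfl⟩ | ⟨hb, rfl⟩
      · exact (hfadj a ha).symm
      · exact hfadj b hb
  obtain ⟨μ', hμ'⟩ := μ.exists_subtype _ hemb
  refine ⟨μ', ?_, ?_, fun s x y hxt hx _ => ?_⟩
  · exact (hμ' {f | f t = v}).trans
      ((PMF.toOuterMeasure_apply_eq_one_iff _ _).2 fun f hf => (hμ f hf).1)
  · exact (hμ' {f | ∀ w, w ≠ t → f w ∈ P (c w)}).trans
      ((PMF.toOuterMeasure_apply_eq_one_iff _ _).2 fun f hf => (hμ f hf).2.1)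
  · have h := hspread (Function.extend x y fun _ => v) (univ.image x) fun w hw => by
      obtain ⟨i, -, rfl⟩ := mem_image.1 hw
      exact mem_erase.2 ⟨hxt i, mem_univ _⟩
    rw [card_image_of_injective _ hx, card_univ, Fintype.card_fin,
      ← ENNReal.ofReal_pow (by positivity)] at h
    refine ((hμ' {f | ∀ i, f (x i) = y i}).trans_le ?_).trans h
    refine MeasureTheory.measure_mono fun f hf w hw => ?_
    obtain ⟨i, -, rfl⟩ := mem_image.1 hw
    rw [hx.extend_apply]
    exact hf i
end

section
/- Let n ∈ ℕ, let s ≤ n, let L₁,…,L_s ⊆ [n], and let x₁,…,x_s be distinct integers in [n]. If π is a uniformly random permutation of [n], then the probability that π(x_i) ∈ L_i for all i ∈ [s] is at most ∏_{i=1}^s (e·|L_i|/n). -/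
/-- At most `(n - s)!` permutations take prescribed values at `s` distinct points. -/
lemma card_perm_comp_eq_le {n s : ℕ} (x y : Fin s → Fin n) (hx : Function.Injective x) :
    Fintype.card {π : Equiv.Perm (Fin n) // ∀ i, π (x i) = y i} ≤ (n - s).factorial := by
  classical
  rcases isEmpty_or_nonempty {π : Equiv.Perm (Fin n) // ∀ i, π (x i) = y i} with h | ⟨⟨σ, hσ⟩⟩
  · simp
  let p : Fin n → Prop := fun a => a ∉ Set.range x
  have hcard : Fintype.card (Subtype p) = n - s := by
    have h := Fintype.card_subtype_compl (fun a => a ∈ Set.range x)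
    have h' : Fintype.card {a // a ∈ Set.range x} = s := by
      rw [← Fintype.card_congr (Equiv.ofInjective x hx), Fintype.card_fin]
    rw [h', Fintype.card_fin] at h
    exact h
  rw [← hcard, ← Fintype.card_perm, Fintype.card_congr (Equiv.Perm.subtypeEquivSubtypePerm p)]
  refine Fintype.card_le_of_injective
    (fun π => ⟨σ⁻¹ * π.1, fun a ha => ?_⟩) fun π τ h => ?_
  · obtain ⟨i, rfl⟩ := not_not.mp ha
    rw [Equiv.Perm.mul_apply, π.2 i, Equiv.Perm.inv_eq_iff_eq, hσ i]
  · exact Subtype.ext (mul_left_cancel (congrArg Subtype.val h))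

/-- The number of permutations sending each `x i` into `L i`. -/
lemma card_perm_mem_le {n s : ℕ} (L : Fin s → Finset (Fin n)) (x : Fin s → Fin n)
    (hx : Function.Injective x) :
    Nat.card {π : Equiv.Perm (Fin n) // ∀ i, π (x i) ∈ L i} ≤
      (n - s).factorial * ∏ i, (L i).card := by
  classical
  rw [Nat.card_eq_fintype_card, Fintype.card_subtype, ← Fintype.card_piFinset]
  refine Finset.card_le_mul_card_image_of_maps_to (f := fun π i => π (x i)) ?_ _ fun y _ => ?_
  · intro π hπ
    simpa using hπ
  · refine le_trans ?_ (card_perm_comp_eq_le x y hx)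
    rw [Fintype.card_subtype]
    refine Finset.card_le_card fun π hπ => ?_
    simp only [Finset.mem_filter, Finset.mem_univ, true_and] at hπ ⊢
    exact fun i => congrFun hπ.2 i

/-- A lower bound `(n / e) ^ s` for the falling factorial. -/
lemma pow_le_exp_pow_mul_descFactorial {n s : ℕ} (hs : s ≤ n) :
    (n : ℝ) ^ s ≤ Real.exp 1 ^ s * n.descFactorial s := by
  induction n generalizing s with
  | zero => simp [Nat.le_zero.mp hs]
  | succ n ih =>
    cases s with
    | zero => simp
    | succ s =>
      have hsn : s ≤ n := by omega
      have key : ((n : ℝ) + 1) ^ s ≤ Real.exp 1 * (n : ℝ) ^ s := by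
        rcases Nat.eq_zero_or_pos n with rfl | hn
        · simp [Nat.le_zero.mp hsn]
        have hn' : (0 : ℝ) < n := by exact_mod_cast hn
        have h1 : (1 / (n : ℝ) + 1) ^ s ≤ Real.exp 1 := by
          calc (1 / (n : ℝ) + 1) ^ s ≤ Real.exp (1 / n) ^ s := by
                gcongr
                exact Real.add_one_le_exp _
            _ = Real.exp (s * (1 / n)) := (Real.exp_nat_mul _ _).symm
            _ ≤ Real.exp 1 := by
                rw [Real.exp_le_exp, mul_one_div, div_le_one hn']
                exact_mod_cast hsn
        calc ((n : ℝ) + 1) ^ s = (1 / (n : ℝ) + 1) ^ s * (n : ℝ) ^ s := by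
              rw [← mul_pow]
              congr 1
              field_simp
              ring
          _ ≤ Real.exp 1 * (n : ℝ) ^ s := by gcongr
      rw [Nat.succ_descFactorial_succ]
      push_cast
      calc ((n : ℝ) + 1) ^ (s + 1) = (n + 1) * ((n : ℝ) + 1) ^ s := by ring
        _ ≤ (n + 1) * (Real.exp 1 * (Real.exp 1 ^ s * n.descFactorial s)) := by
            have := ih hsn
            gcongr
            exact key.trans (by gcongr)
        _ = Real.exp 1 ^ (s + 1) * ((n + 1) * n.descFactorial s) := by ring

/-- spreadness of a uniformly random permutation.
For distinct `x₁,…,x_s ∈ [n]` and sets `L₁,…,L_s ⊆ [n]`, a uniformly random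
permutation `π` of `[n]` satisfies
`ℙ[∀ i, π(xᵢ) ∈ Lᵢ] ≤ ∏ i, e·|Lᵢ|/n`. -/
theorem stmt_6 (n s : ℕ) (hs : s ≤ n) (L : Fin s → Finset (Fin n))
    (x : Fin s → Fin n) (hx : Function.Injective x) :
    (Nat.card {π : Equiv.Perm (Fin n) // ∀ i, π (x i) ∈ L i} : ℝ) / (Nat.factorial n) ≤
      ∏ i : Fin s, Real.exp 1 * ((L i).card : ℝ) / n := by
  have hcount : (Nat.card {π : Equiv.Perm (Fin n) // ∀ i, π (x i) ∈ L i} : ℝ) ≤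
      (n - s).factorial * ∏ i, ((L i).card : ℝ) := by
    exact_mod_cast card_perm_mem_le L x hx
  have hpow := pow_le_exp_pow_mul_descFactorial hs
  have hfact : ((n - s).factorial : ℝ) * n.descFactorial s = n.factorial := by
    exact_mod_cast Nat.factorial_mul_descFactorial hs
  have hpos : (0 : ℝ) < (n : ℝ) ^ s := by
    rcases Nat.eq_zero_or_pos n with rfl | hn
    · simp [Nat.le_zero.mp hs]
    · positivity
  rw [Finset.prod_div_distrib, Finset.prod_mul_distrib]
  simp only [Finset.prod_const, Finset.card_univ, Fintype.card_fin]
  rw [div_le_div_iff₀ (by positivity) hpos, ← hfact]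
  calc _ ≤ ((n - s).factorial * ∏ i, ((L i).card : ℝ)) *
        (Real.exp 1 ^ s * n.descFactorial s) := by gcongr
    _ = _ := by ring
end

section
/- Let n, m ∈ ℕ with 1 ≤ m ≤ n/3. For any n-vertex tree T and any vertex t ∈ V(T), there exist two edge-disjoint subtrees T₁, T₂ of T such that E(T₁) ∪ E(T₂) = E(T), t ∈ V(T₁), and m ≤ |V(T₂)| ≤ 3m. -/
namespace SimpleGraph

variable {V : Type*} {T : SimpleGraph V}

/-- A vertex set containing `v` all of whose outgoing edges start at `v` induces a connected
subgraph of a connected graph. -/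
theorem Connected.induce_of_boundary_eq (hT : T.Connected) {S : Set V} {v : V} (hv : v ∈ S)
    (hS : ∀ x ∈ S, ∀ y ∉ S, T.Adj x y → x = v) : ((⊤ : T.Subgraph).induce S).Connected := by
  rw [← connected_induce_iff]
  have reach : ∀ x w : V, T.Walk x w → w = v → ∀ hx : x ∈ S,
      (T.induce S).Reachable ⟨x, hx⟩ ⟨v, hv⟩ := by
    intro x w p
    induction p with
    | nil => rintro rfl hx; rfl
    | @cons x y w h p ih =>
      intro hw hx
      by_cases hy : y ∈ S
      · have hadj : (T.induce S).Adj ⟨x, hx⟩ ⟨y, hy⟩ := h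
        exact hadj.reachable.trans (ih hw hy)
      · obtain rfl := hS x hx y hy h
        rfl
  rw [connected_iff_exists_forall_reachable]
  exact ⟨⟨v, hv⟩, fun ⟨x, hx⟩ => (reach x v (hT.preconnected x v).some rfl hx).symm⟩

/-- In an acyclic graph, deleting an edge `uv` leaves a set containing `u` and not `v` whose only
outgoing edge is `uv`. -/
theorem IsAcyclic.exists_side_of_adj (hT : T.IsAcyclic) {u v : V} (huv : T.Adj u v) :
    ∃ C : Set V, u ∈ C ∧ v ∉ C ∧ (∀ x ∈ C, ∀ y ∉ C, T.Adj x y → x = u ∧ y = v) := by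
  have hbridge := isAcyclic_iff_forall_adj_isBridge.1 hT huv
  rw [isBridge_iff] at hbridge
  refine ⟨{x | (T.deleteEdges {s(u, v)}).Reachable u x}, Reachable.refl _, ?_, ?_⟩
  · exact hbridge
  · intro x hx y hy hxy
    by_contra hne
    refine hy (Reachable.trans hx (Adj.reachable ?_))
    rw [deleteEdges_adj]
    refine ⟨hxy, fun h => ?_⟩
    rcases Sym2.eq_iff.1 h with h | ⟨rfl, rfl⟩
    · exact hne h
    · exact hy (Reachable.refl _)

/-- A large enough vertex set attached to the rest of a tree only at `v` contains a set of
size between `m` and `3 * m` that is also attached to the rest of the tree at a single vertex. -/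
theorem IsTree.exists_finset_card_le_of_boundary_eq (hT : T.IsTree) {m : ℕ}
    (hm : 1 ≤ m) (t : V) (A : Finset V) (v : V) (hv : v ∈ A) (ht : t ∈ A → t = v)
    (hA : ∀ x ∈ A, ∀ y ∉ A, T.Adj x y → x = v) (hcard : m ≤ A.card) :
    ∃ B : Finset V, ∃ w ∈ B, (t ∈ B → t = w) ∧
      (∀ x ∈ B, ∀ y ∉ B, T.Adj x y → x = w) ∧ m ≤ B.card ∧ B.card ≤ 3 * m := by
  classical
  induction hk : A.card using Nat.strong_induction_on generalizing A v with
  | _ k ih =>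
  subst hk
  by_cases hle : A.card ≤ 3 * m
  · exact ⟨A, v, hv, ht, hA, hcard, hle⟩
  obtain ⟨w, hw, hwv⟩ := Finset.exists_mem_ne (by omega : 1 < A.card) v
  obtain ⟨u, huA, huv, hadj⟩ : ∃ u ∈ A, u ≠ v ∧ T.Adj u v := by
    obtain ⟨d, -, hd₁, hd₂⟩ := (hT.connected.preconnected w v).some.exists_boundary_dart
      {x | x ∈ A ∧ x ≠ v} ⟨hw, hwv⟩ (fun h => h.2 rfl)
    have hsnd : d.snd = v := by
      by_contra hne
      exact hd₁.2 (hA _ hd₁.1 _ (fun h => hd₂ ⟨h, hne⟩) d.adj)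
    exact ⟨d.fst, hd₁.1, hd₁.2, hsnd ▸ d.adj⟩
  obtain ⟨C, huC, hvC, hC⟩ := hT.isAcyclic.exists_side_of_adj hadj
  have hCA : ∀ x ∈ C, x ∈ A := by
    intro x hx
    by_contra hxA
    obtain ⟨d, -, hd₁, hd₂⟩ := (hT.connected.preconnected x u).some.exists_boundary_dart
      {z | z ∈ C ∧ z ∉ A} ⟨hx, hxA⟩ (fun h => h.2 huA)
    by_cases hs : d.snd ∈ C
    · have hsA : d.snd ∈ A := by
        by_contra h
        exact hd₂ ⟨hs, h⟩
      exact hvC (hA _ hsA _ hd₁.2 d.adj.symm ▸ hs)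
    · exact hd₁.2 ((hC _ hd₁.1 _ hs d.adj).1 ▸ huA)
  have hpart : (A.filter (· ∈ C)).card + (A.filter (· ∉ C)).card = A.card :=
    Finset.card_filter_add_card_filter_not _
  have hCpos : 0 < (A.filter (· ∈ C)).card :=
    Finset.card_pos.2 ⟨u, Finset.mem_filter.2 ⟨huA, huC⟩⟩
  have hCcompl : 0 < (A.filter (· ∉ C)).card :=
    Finset.card_pos.2 ⟨v, Finset.mem_filter.2 ⟨hv, hvC⟩⟩
  by_cases hmC : m ≤ (A.filter (· ∈ C)).card
  · refine ih _ (by omega) (A.filter (· ∈ C)) u (Finset.mem_filter.2 ⟨huA, huC⟩) ?_ ?_ hmC rfl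
    · intro h
      rw [Finset.mem_filter] at h
      exact absurd (ht h.1 ▸ h.2) hvC
    · intro x hx y hy hxy
      rw [Finset.mem_filter] at hx hy
      exact (hC x hx.2 y (fun h => hy ⟨hCA y h, h⟩) hxy).1
  · refine ih _ (by omega) (A.filter (· ∉ C)) v (Finset.mem_filter.2 ⟨hv, hvC⟩) ?_ ?_
      (by omega) rfl
    · exact fun h => ht (Finset.mem_filter.1 h).1
    · intro x hx y hy hxy
      rw [Finset.mem_filter] at hx hy
      by_cases hyC : y ∈ C
      · exact (hC y hyC x hx.2 hxy.symm).2
      · exact hA x hx.1 y (fun h => hy ⟨h, hyC⟩) hxy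

end SimpleGraph

/-- splitting a tree into two edge-disjoint subtrees.
Let `1 ≤ m ≤ n/3`. For any `n`-vertex tree `T` and any `t ∈ V(T)` there are
edge-disjoint connected subgraphs (subtrees) `T₁, T₂` of `T` with
`E(T₁) ∪ E(T₂) = E(T)`, `t ∈ V(T₁)` and `m ≤ |V(T₂)| ≤ 3m`. -/
theorem stmt_7 (n m : ℕ) (hm : 1 ≤ m) (hmn : 3 * m ≤ n)
    (V : Type) [Fintype V] (hV : Fintype.card V = n)
    (T : SimpleGraph V) (hT : T.IsTree) (t : V) :
    ∃ T₁ T₂ : T.Subgraph, T₁.Connected ∧ T₂.Connected ∧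
      Disjoint T₁.edgeSet T₂.edgeSet ∧
      T₁.edgeSet ∪ T₂.edgeSet = T.edgeSet ∧
      t ∈ T₁.verts ∧
      m ≤ Nat.card T₂.verts ∧ Nat.card T₂.verts ≤ 3 * m := by
  obtain ⟨B, w, hw, ht, hB, hmB, hBm⟩ :=
    hT.exists_finset_card_le_of_boundary_eq hm t Finset.univ t (Finset.mem_univ _)
      (fun _ => rfl) (fun _ _ y hy => absurd (Finset.mem_univ y) hy)
      (by rw [Finset.card_univ, hV]; omega)
  refine ⟨(⊤ : T.Subgraph).induce {x | x ∈ B → x = w}, (⊤ : T.Subgraph).induce B,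
    hT.connected.induce_of_boundary_eq (v := w) (fun _ => rfl) ?_,
    hT.connected.induce_of_boundary_eq (v := w) hw hB, ?_, ?_, ht, ?_, ?_⟩
  · intro x hx y hy hxy
    simp only [Set.mem_ofPred_eq, Classical.not_imp] at hx hy
    by_contra hne
    exact hy.2 (hB y hy.1 x (fun h => hne (hx h)) hxy.symm)
  · rw [Set.disjoint_left]
    intro e
    induction e with
    | _ x y =>
    simp only [SimpleGraph.Subgraph.mem_edgeSet, SimpleGraph.Subgraph.induce_adj]
    rintro ⟨hx, hy, hxy⟩ ⟨hxB, hyB, -⟩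
    exact T.ne_of_adj hxy ((hx hxB).trans (hy hyB).symm)
  · ext e
    induction e with
    | _ x y =>
    simp only [Set.mem_union, SimpleGraph.Subgraph.mem_edgeSet, SimpleGraph.Subgraph.induce_adj,
      SimpleGraph.mem_edgeSet, SimpleGraph.Subgraph.top_adj, Set.mem_ofPred_eq, Finset.mem_coe]
    constructor
    · rintro (h | h) <;> exact h.2.2
    · intro h
      have hxy := hB x
      have hyx := hB y
      have h' := h.symm
      grind
  · simpa using hmB
  · simpa using hBm
end

section
/- Let n, m ∈ ℕ with m ≤ n. For any n-vertex tree T there exists a tree-splitting (T_i)_{i ∈ [ℓ]} of T such that for each i ∈ [ℓ] we have m ≤ |V(T_i)| ≤ 4m. -/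
open SimpleGraph

namespace SimpleGraph

variable {V : Type*} {G : SimpleGraph V}

/-- In a connected graph every vertex other than `r` has a neighbour closer to `r`. -/
lemma Connected.exists_adj_dist_lt (hG : G.Connected) (r v : V) (hv : v ≠ r) :
    ∃ w, G.Adj v w ∧ G.dist r w < G.dist r v := by
  obtain ⟨q, hq⟩ := hG.exists_walk_length_eq_dist v r
  cases q with
  | nil => exact absurd rfl hv
  | cons h q =>
    refine ⟨_, h, ?_⟩
    rw [dist_comm, G.dist_comm (u := r), ← hq, Walk.length_cons]
    exact Nat.lt_succ_of_le (dist_le q)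

/-- In a tree, every edge joins a vertex to its chosen parent. -/
lemma IsTree.exists_eq_parent_edge [Fintype V] (hG : G.IsTree) {r : V} {p : V → V} {f : V → ℕ}
    (hp : ∀ v, v ≠ r → G.Adj v (p v) ∧ f (p v) < f v) {e : Sym2 V} (he : e ∈ G.edgeSet) :
    ∃ v, v ≠ r ∧ e = s(v, p v) := by
  classical
  have hinj : Set.InjOn (fun v => s(v, p v)) (Finset.univ.erase r : Finset V) := by
    intro v hv w hw h
    have hv' := hp v (by simpa using hv)
    have hw' := hp w (by simpa using hw)
    rcases Sym2.eq_iff.1 h with h | h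
    · exact h.1
    · rw [h.2] at hv'
      rw [← h.1] at hw'
      omega
  have hsub : (Finset.univ.erase r).image (fun v => s(v, p v)) ⊆ G.edgeFinset := by
    intro e he
    obtain ⟨v, hv, rfl⟩ := Finset.mem_image.1 he
    simpa using (hp v (by simpa using hv)).1
  have heq := Finset.eq_of_subset_of_card_le hsub (by
    rw [Finset.card_image_of_injOn hinj, Finset.card_erase_of_mem (Finset.mem_univ r),
      Finset.card_univ, ← hG.card_edgeFinset, Nat.add_sub_cancel])
  have he' : e ∈ G.edgeFinset := by simpa using he
  rw [← heq] at he'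
  obtain ⟨v, hv, rfl⟩ := Finset.mem_image.1 he'
  exact ⟨v, by simpa using hv, rfl⟩

namespace Subgraph

lemma card_verts_sup_le [Finite V] (H K : G.Subgraph) :
    Nat.card (H ⊔ K).verts ≤ Nat.card H.verts + Nat.card K.verts := by
  simpa only [Nat.card_coe_set_eq, verts_sup] using Set.ncard_union_le H.verts K.verts

/-- Two connected subgraphs joined by an edge. -/
lemma exists_connected_join [Finite V] {H K : G.Subgraph} (hH : H.Connected) (hK : K.Connected)
    {a b : V} (ha : a ∈ H.verts) (hb : b ∈ K.verts) (hab : G.Adj a b) :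
    ∃ M : G.Subgraph, M.Connected ∧ b ∈ M.verts ∧
      Nat.card M.verts ≤ Nat.card H.verts + Nat.card K.verts ∧
      ∀ e, e ∈ M.edgeSet ↔ e ∈ H.edgeSet ∨ e ∈ K.edgeSet ∨ e = s(a, b) := by
  refine ⟨H ⊔ G.subgraphOfAdj hab ⊔ K, ?_, ?_, ?_, ?_⟩
  · refine connected_sup (connected_sup hH.preconnected
      (subgraphOfAdj_connected hab).preconnected ⟨a, ?_⟩).preconnected hK.preconnected ⟨b, ?_⟩ <;> simp [ha, hb]
  · simp
  · have : (H ⊔ G.subgraphOfAdj hab ⊔ K).verts = (H ⊔ K).verts := by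
      ext x
      simp only [verts_sup, subgraphOfAdj_verts, Set.mem_union, Set.mem_insert_iff,
        Set.mem_singleton_iff]
      grind
    rw [this]
    exact card_verts_sup_le H K
  · intro e
    simp only [edgeSet_sup, edgeSet_subgraphOfAdj, Set.mem_union, Set.mem_singleton_iff]
    tauto

end Subgraph

/-- The edges from the vertices of `P` to their parents split into subgraphs of between `m` and
`2 * m` vertices, together with a remainder of at most `m` vertices hanging at each vertex
outside `P`. -/
lemma exists_splitting_with_remainders [Finite V] {m : ℕ} (hm : 1 ≤ m) {r : V} {p : V → V}
    {f : V → ℕ} (hp : ∀ v, v ≠ r → G.Adj v (p v) ∧ f (p v) < f v) (P : Finset V) (hr : r ∉ P) :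
    ∃ (C : Set G.Subgraph) (R : V → G.Subgraph),
      (∀ H ∈ C, H.Connected ∧ m ≤ Nat.card H.verts ∧ Nat.card H.verts ≤ 2 * m) ∧
      (∀ v, (R v).Connected ∧ v ∈ (R v).verts ∧ Nat.card (R v).verts ≤ m) ∧
      (∀ v ∈ P, (R v).edgeSet = ∅) ∧
      (∀ H ∈ C, ∀ K ∈ C, ∀ e, e ∈ H.edgeSet → e ∈ K.edgeSet → H = K) ∧
      (∀ v w e, e ∈ (R v).edgeSet → e ∈ (R w).edgeSet → v = w) ∧
      (∀ v, ∀ H ∈ C, ∀ e, e ∈ (R v).edgeSet → e ∉ H.edgeSet) ∧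
      (∀ H ∈ C, ∀ e ∈ H.edgeSet, ∃ v ∈ P, e = s(v, p v)) ∧
      (∀ w, ∀ e ∈ (R w).edgeSet, ∃ v ∈ P, e = s(v, p v)) ∧
      (∀ v ∈ P, (∃ H ∈ C, s(v, p v) ∈ H.edgeSet) ∨ ∃ w, s(v, p v) ∈ (R w).edgeSet) := by
  classical
  have htriv : ∀ v : V, (G.singletonSubgraph v).Connected ∧ v ∈ (G.singletonSubgraph v).verts ∧
      Nat.card (G.singletonSubgraph v).verts ≤ m ∧ (G.singletonSubgraph v).edgeSet = ∅ := by
    intro v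
    refine ⟨Subgraph.singletonSubgraph_connected, by simp, by simpa using hm, by simp⟩
  induction P using Finset.induction_on_min_value f with
  | empty =>
    refine ⟨∅, fun v => G.singletonSubgraph v, ?_⟩
    simp [Subgraph.singletonSubgraph_connected, hm]
  | insert a P haP hmin ih =>
    obtain ⟨C, R, hC, hR, hRP, hCC, hRR, hRC, hCe, hRe, hcov⟩ := ih (by grind)
    obtain ⟨hadj, hlt⟩ := hp a (by grind)
    have hbP : p a ∉ P := fun h => by have := hmin _ h; omega
    have hba : p a ≠ a := hadj.ne'
    have hnew : ∀ v ∈ P, s(a, p a) ≠ s(v, p v) := by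
      intro v hv h
      rcases Sym2.eq_iff.1 h with h | h <;> grind
    obtain ⟨M, hM, hbM, hMcard, hMe⟩ :=
      Subgraph.exists_connected_join (hR a).1 (hR (p a)).1 (hR a).2.1 (hR (p a)).2.1 hadj
    have hacard := (hR a).2.2
    have hbcard := (hR (p a)).2.2
    obtain ⟨E, hE⟩ : ∃ E : V → Sym2 V, ∀ v, s(v, p v) = E v := ⟨_, fun _ => rfl⟩
    simp only [hE] at hnew hCe hRe hcov hMe
    have hupd : ∀ X : G.Subgraph, X.Connected → p a ∈ X.verts → Nat.card X.verts ≤ m →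
        ∃ R' : V → G.Subgraph,
          (∀ v, (R' v).Connected ∧ v ∈ (R' v).verts ∧ Nat.card (R' v).verts ≤ m) ∧
          (∀ v ∈ insert a P, (R' v).edgeSet = ∅) ∧
          ∀ v e, e ∈ (R' v).edgeSet ↔
            (v ≠ a ∧ v ≠ p a ∧ e ∈ (R v).edgeSet) ∨ (v = p a ∧ e ∈ X.edgeSet) := by
      intro X hX hbX hXcard
      have hbP' : p a ∉ insert a P := by simp [hba, hbP]
      refine ⟨Function.update (Function.update R a (G.singletonSubgraph a)) (p a) X,
        fun v => ?_, fun v hv => ?_, fun v e => ?_⟩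
      · by_cases hvb : v = p a
        · subst hvb
          simpa using ⟨hX, hbX, hXcard⟩
        · by_cases hva : v = a
          · subst hva
            simpa [hvb] using ⟨(htriv v).1, hm⟩
          · simpa [hva, hvb] using hR v
      · have hvb : v ≠ p a := fun h => hbP' (h ▸ hv)
        rcases Finset.mem_insert.1 hv with rfl | hv
        · simp [hvb]
        · have hva : v ≠ a := fun h => haP (h ▸ hv)
          simpa [hva, hvb] using hRP v hv
      · by_cases hvb : v = p a
        · subst hvb
          simp
        · by_cases hva : v = a
          · subst hva
            simp [hvb]
          · simp [hva, hvb]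
    by_cases hle : Nat.card M.verts ≤ m
    · obtain ⟨R', hR', hR'P, hR'e⟩ := hupd M hM hbM hle
      refine ⟨C, R', hC, hR', hR'P, hCC, ?_, ?_, ?_, ?_, ?_⟩
      all_goals
        clear ih hp hmin hC hr hadj hlt hRP hupd htriv hR hR' hR'P hM hbM hMcard hacard hbcard hle
        simp only [hE, Finset.mem_insert, hR'e]
        grind
    · obtain ⟨R', hR', hR'P, hR'e⟩ := hupd (G.singletonSubgraph (p a)) (htriv _).1 (htriv _).2.1
        (htriv _).2.2.1
      simp only [(htriv _).2.2.2, Set.mem_empty_iff_false, and_false, or_false] at hR'e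
      refine ⟨insert M C, R', ?_, hR', hR'P, ?_, ?_, ?_, ?_, ?_, ?_⟩
      · rintro H (rfl | hH)
        · exact ⟨hM, by omega, by omega⟩
        · exact hC H hH
      all_goals
        clear ih hp hmin hC hr hadj hlt hRP hupd htriv hR hR' hR'P hM hbM hMcard hacard hbcard hle
        simp only [hE, Finset.mem_insert, hR'e, Set.mem_insert_iff]
        grind

end SimpleGraph

/-- tree-splitting into pieces of roughly equal size.
Let `1 ≤ m ≤ n`. For any `n`-vertex tree `T` there is a tree-splitting
`(T_i)_{i ∈ [ℓ]}` of `T` (a family of pairwise edge-disjoint connected subgraphs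
whose edge sets cover `E(T)`) with `m ≤ |V(T_i)| ≤ 4m` for each `i`. -/
theorem stmt_8 (n m : ℕ) (hm : 1 ≤ m) (hmn : m ≤ n)
    (V : Type) [Fintype V] (hV : Fintype.card V = n)
    (T : SimpleGraph V) (hT : T.IsTree) :
    ∃ (ℓ : ℕ) (Ts : Fin ℓ → T.Subgraph),
      (∀ i, (Ts i).Connected) ∧
      (∀ i j, i ≠ j → Disjoint (Ts i).edgeSet (Ts j).edgeSet) ∧
      (⋃ i, (Ts i).edgeSet) = T.edgeSet ∧
      ∀ i, m ≤ Nat.card (Ts i).verts ∧ Nat.card (Ts i).verts ≤ 4 * m := by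
  classical
  suffices h : ∃ C : Set T.Subgraph,
      (∀ H ∈ C, H.Connected ∧ m ≤ Nat.card H.verts ∧ Nat.card H.verts ≤ 4 * m) ∧
      (∀ H ∈ C, ∀ K ∈ C, ∀ e, e ∈ H.edgeSet → e ∈ K.edgeSet → H = K) ∧
      ∀ e ∈ T.edgeSet, ∃ H ∈ C, e ∈ H.edgeSet by
    obtain ⟨C, hC, hCC, hcov⟩ := h
    have e := Finite.equivFin C
    refine ⟨_, fun i => (e.symm i).1, fun i => (hC _ (e.symm i).2).1, fun i j hij => ?_, ?_,
      fun i => (hC _ (e.symm i).2).2⟩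
    · refine Set.disjoint_left.2 fun x hi hj => hij (e.symm.injective (Subtype.ext ?_))
      exact hCC _ (e.symm i).2 _ (e.symm j).2 x hi hj
    · refine Set.Subset.antisymm (Set.iUnion_subset fun i => Subgraph.edgeSet_subset _) ?_
      intro x hx
      obtain ⟨H, hH, hxH⟩ := hcov x hx
      exact Set.mem_iUnion.2 ⟨e ⟨H, hH⟩, by simpa only [e.symm_apply_apply] using hxH⟩
  obtain ⟨r⟩ := hT.1.nonempty
  have hpar : ∀ v, ∃ w, v ≠ r → T.Adj v w ∧ T.dist r w < T.dist r v := by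
    intro v
    by_cases hv : v = r
    · exact ⟨v, fun h => absurd hv h⟩
    · obtain ⟨w, hw⟩ := hT.1.exists_adj_dist_lt r v hv
      exact ⟨w, fun _ => hw⟩
  choose p hp using hpar
  obtain ⟨C, R, hC, hR, hRP, hCC, -, hRC, -, -, hcov⟩ :=
    exists_splitting_with_remainders hm hp (Finset.univ.erase r) (by simp)
  have hcov' : ∀ e ∈ T.edgeSet, (∃ H ∈ C, e ∈ H.edgeSet) ∨ e ∈ (R r).edgeSet := by
    intro e he
    obtain ⟨v, hv, rfl⟩ := hT.exists_eq_parent_edge hp he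
    rcases hcov v (by simpa using hv) with h | ⟨w, hw⟩
    · exact Or.inl h
    · by_cases hwr : w = r
      · exact Or.inr (hwr ▸ hw)
      · simp [hRP w (by simpa using hwr)] at hw
  obtain ⟨hRconn, hrR, hRcard⟩ := hR r
  by_cases huniv : (R r).verts = Set.univ
  · refine ⟨{⊤}, ?_, by simp, by simp⟩
    have : n ≤ m := by simpa [huniv, hV] using hRcard
    have htop : (⊤ : T.Subgraph).Connected := Subgraph.connected_iff'.2
      ((Subgraph.topIso (G := T)).connected_iff.2 hT.1)
    simp [htop, hV]
    omega
  · have hne : (Finset.univ.filter fun v => v ∉ (R r).verts).Nonempty := by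
      obtain ⟨v, hv⟩ := (Set.ne_univ_iff_exists_notMem _).1 huniv
      exact ⟨v, by simpa using hv⟩
    obtain ⟨v, hv, hvmin⟩ := Finset.exists_min_image _ (T.dist r) hne
    have hvR : v ∉ (R r).verts := by simpa using hv
    obtain ⟨hadj, hlt⟩ := hp v (by grind)
    have hpv : p v ∈ (R r).verts := by
      by_contra h
      exact absurd (hvmin (p v) (by simpa using h)) (by omega)
    obtain ⟨H, hHC, hH⟩ := (hcov' s(v, p v) hadj).resolve_right
      fun h => hvR (Subgraph.edge_vert _ h)
    have hpH : p v ∈ H.verts := Subgraph.edge_vert _ (Subgraph.Adj.symm hH)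
    have hconn : (H ⊔ R r).Connected := Subgraph.connected_sup (hC H hHC).1.preconnected
      hRconn.preconnected ⟨p v, hpH, hpv⟩
    have hcard := Subgraph.card_verts_sup_le H (R r)
    have hcard' : Nat.card H.verts ≤ Nat.card (H ⊔ R r).verts :=
      Nat.card_mono (Set.toFinite _) (by simp)
    have hedge : ∀ e, e ∈ (H ⊔ R r).edgeSet ↔ e ∈ H.edgeSet ∨ e ∈ (R r).edgeSet := by simp
    refine ⟨insert (H ⊔ R r) (C \ {H}), ?_, ?_, ?_⟩
    all_goals simp only [Set.mem_insert_iff, Set.mem_sdiff, Set.mem_singleton_iff]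
    · grind
    · grind
    · grind
end

section
/- For every k ∈ ℕ there exists n₀ ∈ ℕ such that for all n ≥ n₀ the following holds. Let G be a bipartite graph with parts A and B where |A| = n and |B| = kn, such that every a ∈ A satisfies deg(a, B) ≥ (99/100)|B| and every b ∈ B satisfies deg(b, A) ≥ (99/100)|A|. Then there exists a partition of B into sets B₁,…,B_k, each of size exactly n, such that for every i ∈ [k] the bipartite graph induced by G between A and B_i has minimum degree at least (98/100)n. -/
open Finset in
/-- If every set `{p | bad a p}` has size at most `δ * (k * n)`, then some choice of cyclic shifts of
the `n` blocks `Fin k` keeps the total exponential moment of the sizes of the intersections with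
all shifted transversals at most `|A| * k * exp (δ * n)`. -/
lemma exists_shift_sum_two_pow_le {A : Type*} [Fintype A] (n k : ℕ) [NeZero k] (δ : ℝ)
    (bad : A → Fin n × Fin k → Prop) [∀ a, DecidablePred (bad a)]
    (hbad : ∀ a, (#{p | bad a p} : ℝ) ≤ δ * (k * n)) :
    ∃ s : Fin n → Fin k, ∑ q : A × Fin k, (2 : ℝ) ^ #{j | bad q.1 (j, q.2 - s j)} ≤
      Fintype.card A * k * Real.exp (δ * n) := by
  have hk : (0 : ℝ) < k := by exact_mod_cast Nat.pos_of_ne_zero (NeZero.ne k)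
  have moment (q : A × Fin k) :
      ∑ s : Fin n → Fin k, (2 : ℝ) ^ #{j | bad q.1 (j, q.2 - s j)} ≤
        k ^ n * Real.exp (δ * n) := by
    have block (j : Fin n) :
        ∑ t : Fin k, (if bad q.1 (j, q.2 - t) then (2 : ℝ) else 1) ≤
          k * Real.exp (#{x | bad q.1 (j, x)} / k) := by
      have shift : ∑ t : Fin k, (if bad q.1 (j, q.2 - t) then (2 : ℝ) else 1) =
          ∑ x : Fin k, (if bad q.1 (j, x) then (2 : ℝ) else 1) :=
        (Equiv.subLeft q.2).sum_comp fun x ↦ if bad q.1 (j, x) then (2 : ℝ) else 1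
      have count : ∑ x : Fin k, (if bad q.1 (j, x) then (2 : ℝ) else 1) =
          k + #{x | bad q.1 (j, x)} := by
        have (x : Fin k) : (if bad q.1 (j, x) then (2 : ℝ) else 1) =
            1 + if bad q.1 (j, x) then 1 else 0 := by split_ifs <;> norm_num
        simp [this, sum_add_distrib]
      rw [shift, count]
      calc (k : ℝ) + #{x | bad q.1 (j, x)} = k * (#{x | bad q.1 (j, x)} / k + 1) := by
            field_simp
            ring
        _ ≤ _ := by gcongr; exact Real.add_one_le_exp _
    have total : (∑ j : Fin n, (#{x | bad q.1 (j, x)} : ℝ)) = #{p | bad q.1 p} := by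
      simp only [card_filter, Fintype.sum_prod_type]
      push_cast
      rfl
    calc ∑ s : Fin n → Fin k, (2 : ℝ) ^ #{j | bad q.1 (j, q.2 - s j)}
        = ∑ s : Fin n → Fin k, ∏ j, (if bad q.1 (j, q.2 - s j) then (2 : ℝ) else 1) := by
          simp [prod_ite]
      _ = ∏ j, ∑ t : Fin k, (if bad q.1 (j, q.2 - t) then (2 : ℝ) else 1) := by
          rw [prod_univ_sum, Fintype.piFinset_univ]
      _ ≤ ∏ j : Fin n, (k * Real.exp (#{x | bad q.1 (j, x)} / k)) := by
          refine prod_le_prod (fun j _ ↦ sum_nonneg fun t _ ↦ ?_) fun j _ ↦ block j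
          split_ifs <;> norm_num
      _ = k ^ n * Real.exp (#{p | bad q.1 p} / k) := by
          rw [prod_mul_distrib, ← Real.exp_sum, ← sum_div, total]
          simp
      _ ≤ _ := by
          gcongr
          rw [div_le_iff₀ hk]
          linarith [hbad q.1]
  obtain ⟨s, -, hs⟩ := exists_le_of_sum_le (s := (univ : Finset (Fin n → Fin k)))
    (f := fun s ↦ ∑ q : A × Fin k, (2 : ℝ) ^ #{j | bad q.1 (j, q.2 - s j)})
    (g := fun _ ↦ Fintype.card A * k * Real.exp (δ * n)) univ_nonempty (by
      rw [sum_comm]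
      refine (sum_le_sum fun q _ ↦ moment q).trans_eq ?_
      simp
      ring)
  exact ⟨s, hs⟩

lemma le_div_fifty_of_two_pow_le {n k m : ℕ} (hn : 300000 * (k + 1) ≤ n)
    (h : (2 : ℝ) ^ m ≤ n * k * Real.exp (1 / 100 * n)) : (m : ℝ) ≤ n / 50 := by
  by_contra! hm
  have hnk : (300000 : ℝ) * (k + 1) ≤ n := by exact_mod_cast hn
  have hk : (0 : ℝ) ≤ k := k.cast_nonneg
  have hquad := Real.quadratic_le_exp_of_nonneg (x := 3 / 1000 * (n : ℝ)) (by positivity)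
  have hlt : (n : ℝ) * k < Real.exp (3 / 1000 * n) := by nlinarith
  have hpow : Real.exp (3 / 1000 * n) * Real.exp (1 / 100 * n) ≤ (2 : ℝ) ^ m := by
    rw [← Real.exp_add, ← Real.exp_log (show (0 : ℝ) < 2 by norm_num), ← Real.exp_nat_mul]
    apply Real.exp_le_exp.2
    nlinarith [Real.log_two_gt_d9]
  exact (h.trans_lt (mul_lt_mul_of_pos_right hlt (Real.exp_pos _))).not_ge hpow

/-- equipartitioning the big side of a dense bipartite graph.
For every `k` there is `n₀` such that for all `n ≥ n₀`: if `G` is bipartite with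
parts `A`, `B`, `|A| = n`, `|B| = kn`, `deg(a,B) ≥ (99/100)|B|` for all `a ∈ A` and
`deg(b,A) ≥ (99/100)|A|` for all `b ∈ B`, then `B` can be partitioned into sets
`B₁,…,B_k` (given by the fibres of a map `P : B → Fin k`), each of size exactly `n`,
such that each induced bipartite graph between `A` and `B_i` has minimum degree at
least `(98/100)n`. -/
theorem stmt_9 (k : ℕ) :
    ∃ n₀ : ℕ, ∀ n : ℕ, n₀ ≤ n →
      ∀ (A B : Type) [Fintype A] [Fintype B] (E : A → B → Prop),
        Fintype.card A = n → Fintype.card B = k * n →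
        (∀ a : A, (99 : ℝ) / 100 * (Fintype.card B) ≤ (Nat.card {b : B // E a b} : ℝ)) →
        (∀ b : B, (99 : ℝ) / 100 * (Fintype.card A) ≤ (Nat.card {a : A // E a b} : ℝ)) →
        ∃ P : B → Fin k,
          (∀ i : Fin k, Nat.card {b : B // P b = i} = n) ∧
          (∀ i : Fin k, ∀ a : A,
            (98 : ℝ) / 100 * n ≤ (Nat.card {b : B // P b = i ∧ E a b} : ℝ)) ∧
          (∀ i : Fin k, ∀ b : B, P b = i →
            (98 : ℝ) / 100 * n ≤ (Nat.card {a : A // E a b} : ℝ)) := by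
  classical
  refine ⟨300000 * (k + 1), fun n hn A B _ _ E hA hB hdegA hdegB ↦ ?_⟩
  have hdeg (b : B) : (98 : ℝ) / 100 * n ≤ (Nat.card {a : A // E a b} : ℝ) := by
    have := hdegB b
    rw [hA] at this
    linarith [n.cast_nonneg (α := ℝ)]
  rcases Nat.eq_zero_or_pos k with rfl | hk
  · have : IsEmpty B := Fintype.card_eq_zero_iff.1 (by simpa using hB)
    exact ⟨isEmptyElim, fun i ↦ i.elim0, fun i ↦ i.elim0, fun i ↦ i.elim0⟩
  have : NeZero k := ⟨hk.ne'⟩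
  let e : B ≃ Fin n × Fin k := Fintype.equivOfCardEq (by simp [hB, mul_comm])
  have hbad (a : A) :
      (Finset.card {p | ¬ E a (e.symm p)} : ℝ) ≤ 1 / 100 * (k * n) := by
    have hcard : Finset.card {p | ¬ E a (e.symm p)} = Fintype.card {b // ¬ E a b} := by
      rw [← Fintype.card_subtype]
      exact Fintype.card_congr (e.symm.subtypeEquiv fun p ↦ Iff.rfl)
    have hcompl := Fintype.card_subtype_compl (E a)
    have hle := Fintype.card_subtype_le (E a)
    have hsum : (Fintype.card {b // ¬ E a b} : ℝ) + Fintype.card {b // E a b} = k * n := by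
      rw [hB] at hcompl hle
      exact_mod_cast (by omega :
        Fintype.card {b // ¬ E a b} + Fintype.card {b // E a b} = k * n)
    have := hdegA a
    rw [Nat.card_eq_fintype_card, hB] at this
    push_cast at this
    rw [hcard]
    linarith
  obtain ⟨s, hs⟩ := exists_shift_sum_two_pow_le n k (1 / 100)
    (fun a p ↦ ¬ E a (e.symm p)) hbad
  rw [hA] at hs
  let fibre (i : Fin k) : {b : B // (e b).2 + s (e b).1 = i} ≃ Fin n :=
    { toFun := fun b ↦ (e b).1
      invFun := fun j ↦ ⟨e.symm (j, i - s j), by simp⟩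
      left_inv := by
        rintro ⟨b, rfl⟩
        simp
      right_inv := fun j ↦ by simp }
  refine ⟨fun b ↦ (e b).2 + s (e b).1, fun i ↦ ?_, fun i a ↦ ?_, fun i b _ ↦ hdeg b⟩
  · simpa using Nat.card_congr (fibre i)
  · have hgood : Nat.card {b : B // (e b).2 + s (e b).1 = i ∧ E a b} =
        Finset.card {j | E a (e.symm (j, i - s j))} := by
      rw [← Fintype.card_subtype, ← Nat.card_eq_fintype_card]
      refine Nat.card_congr ((Equiv.subtypeSubtypeEquivSubtypeInter _ _).symm.trans
        ((fibre i).symm.subtypeEquiv fun j ↦ Iff.rfl).symm)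
    have hsplit := Finset.card_filter_add_card_filter_not (s := (Finset.univ : Finset (Fin n)))
      (fun j ↦ E a (e.symm (j, i - s j)))
    rw [Finset.card_univ, Fintype.card_fin] at hsplit
    have hfew := le_div_fifty_of_two_pow_le hn
      ((Finset.single_le_sum (f := fun q : A × Fin k ↦
        (2 : ℝ) ^ Finset.card {j | ¬ E q.1 (e.symm (j, q.2 - s j))})
        (fun q _ ↦ by positivity) (Finset.mem_univ (a, i))).trans hs)
    rw [hgood]
    have : (_ : ℝ) = n := congrArg Nat.cast hsplit
    push_cast at this
    linarith
end
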